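/- arXiv:0903.3674 — 5 statements merged into one kernel-verified Lean document; each statement's English description precedes it below -/
import Mathlib

section
/- Let p > 0 and x > 0 be real numbers, and let y₁ > y₂ ≥ 3p. With r_{y_i} = √((y_i − p)² + x²) for i = 1, 2, one has ((y₁ − p) + r_{y₁}) / ((y₂ − p) + r_{y₂}) < (9/4)·(y₁/y₂); equivalently, log(((y₁−p) + r_{y₁})/((y₂−p) + r_{y₂})) < log(y₁/y₂) + log(9/4). -/
/-- The map `t ↦ √(t² + x²) / t` is antitone on the positive reals. -/
theorem mul_sqrt_sq_add_sq_le {a b : ℝ} (x : ℝ) (hb : 0 ≤ b) (hab : b ≤ a) :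
    b * Real.sqrt (a ^ 2 + x ^ 2) ≤ a * Real.sqrt (b ^ 2 + x ^ 2) := by
  have ha : 0 ≤ a := hb.trans hab
  apply le_of_sq_le_sq _ (by positivity)
  rw [mul_pow, mul_pow, Real.sq_sqrt (by positivity), Real.sq_sqrt (by positivity)]
  have h : b ^ 2 * x ^ 2 ≤ a ^ 2 * x ^ 2 := by gcongr
  linarith

theorem stmt_8 (p x y₁ y₂ : ℝ) (hp : 0 < p) (hx : 0 < x)
    (h12 : y₂ < y₁) (h2 : 3 * p ≤ y₂)
    (r₁ r₂ : ℝ) (hr₁ : r₁ = Real.sqrt ((y₁ - p) ^ 2 + x ^ 2))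
    (hr₂ : r₂ = Real.sqrt ((y₂ - p) ^ 2 + x ^ 2)) :
    ((y₁ - p) + r₁) / ((y₂ - p) + r₂) < 9 / 4 * (y₁ / y₂) ∧
    Real.log (((y₁ - p) + r₁) / ((y₂ - p) + r₂)) <
      Real.log (y₁ / y₂) + Real.log (9 / 4) := by
  have hb : 0 < y₂ - p := by linarith
  have ha : 0 < y₁ - p := by linarith
  have hy₂ : 0 < y₂ := by linarith
  have hy₁ : 0 < y₁ := by linarith
  have hr₁0 : 0 ≤ r₁ := hr₁ ▸ Real.sqrt_nonneg _
  have hr₂0 : 0 ≤ r₂ := hr₂ ▸ Real.sqrt_nonneg _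
  have hr : (y₂ - p) * r₁ ≤ (y₁ - p) * r₂ := by
    rw [hr₁, hr₂]
    exact mul_sqrt_sq_add_sq_le x hb.le (by linarith)
  have hlt : ((y₁ - p) + r₁) / ((y₂ - p) + r₂) < 9 / 4 * (y₁ / y₂) := by
    calc ((y₁ - p) + r₁) / ((y₂ - p) + r₂) ≤ (y₁ - p) / (y₂ - p) := by
          rw [div_le_div_iff₀ (by linarith) hb]
          linarith
      _ < 9 / 4 * (y₁ / y₂) := by
          rw [← mul_div_assoc, div_lt_div_iff₀ hb hy₂]
          nlinarith [mul_pos hp hy₂, mul_pos hy₁ hy₂, mul_le_mul_of_nonneg_left h2 hy₁.le]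
  refine ⟨hlt, ?_⟩
  rw [← Real.log_mul (by positivity) (by norm_num), mul_comm]
  exact Real.log_lt_log (by positivity) hlt
end

section
/- Let p ≤ 0 < y₂ < y₁ be real numbers and let x ∈ ℝ. With r_{y_i} = √((y_i − p)² + x²) for i = 1, 2, one has (r_{y₁} + (y₁ − p)) / (r_{y₂} + (y₂ − p)) ≤ y₁/y₂. -/
theorem stmt_10 (p y₁ y₂ x : ℝ) (hp : p ≤ 0) (h2 : 0 < y₂) (h12 : y₂ < y₁)
    (r₁ r₂ : ℝ) (hr₁ : r₁ = Real.sqrt ((y₁ - p) ^ 2 + x ^ 2))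
    (hr₂ : r₂ = Real.sqrt ((y₂ - p) ^ 2 + x ^ 2)) :
    (r₁ + (y₁ - p)) / (r₂ + (y₂ - p)) ≤ y₁ / y₂ := by
  have h1 : 0 < y₁ := h2.trans h12
  have hr₂_nonneg : 0 ≤ r₂ := hr₂ ▸ Real.sqrt_nonneg _
  have hsq₁ : r₁ ^ 2 = (y₁ - p) ^ 2 + x ^ 2 := by rw [hr₁, Real.sq_sqrt (by positivity)]
  have hsq₂ : r₂ ^ 2 = (y₂ - p) ^ 2 + x ^ 2 := by rw [hr₂, Real.sq_sqrt (by positivity)]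
  have hp_mul : p * y₁ ≤ p * y₂ := mul_le_mul_of_nonpos_left h12.le hp
  have hproj : ((y₁ - p) * y₂) ^ 2 ≤ (y₁ * (y₂ - p)) ^ 2 :=
    pow_le_pow_left₀ (mul_nonneg (by linarith) h2.le) (by linarith) 2
  have hx : (x * y₂) ^ 2 ≤ (x * y₁) ^ 2 := by
    rw [mul_pow, mul_pow]
    gcongr
  have hr : r₁ * y₂ ≤ y₁ * r₂ := by
    refine (sq_le_sq₀ (by rw [hr₁]; positivity) (by positivity)).mp ?_
    rw [mul_pow, mul_pow, hsq₁, hsq₂]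
    linarith
  rw [div_le_div_iff₀ (by linarith) h2]
  linarith
end

section
/- Let d ≥ 2 be an integer, let C be a real number with 0 < C ≤ 2π, and let ζ ∈ [0,1]. Then (1 + C/d − ζ) / √(ζ² − 2ζ·cos(2π/d) + 1) ≥ C/(2π). -/
open Real

theorem sqrt_sq_sub_two_mul_cos_add_one_le {ζ θ : ℝ} (h0 : 0 ≤ ζ) (h1 : ζ ≤ 1) (hθ : 0 ≤ θ) :
    √(ζ ^ 2 - 2 * ζ * cos θ + 1) ≤ 1 - ζ + θ := by
  refine Real.sqrt_le_iff.mpr ⟨by linarith, ?_⟩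
  have hcos := mul_le_mul_of_nonneg_left (one_sub_sq_div_two_le_cos (x := θ)) h0
  nlinarith [mul_nonneg (sub_nonneg.mpr h1) hθ, mul_nonneg (sub_nonneg.mpr h1) (sq_nonneg θ)]

theorem sq_sub_two_mul_cos_add_one_pos {ζ θ : ℝ} (h0 : 0 ≤ ζ) (hcos : cos θ < 1) :
    0 < ζ ^ 2 - 2 * ζ * cos θ + 1 := by
  rcases h0.eq_or_lt with rfl | h0
  · simp
  · nlinarith [sq_nonneg (1 - ζ), mul_pos h0 (sub_pos.mpr hcos)]

theorem stmt_11 (d : ℕ) (hd : 2 ≤ d) (C : ℝ) (hC0 : 0 < C) (hC : C ≤ 2 * π)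
    (ζ : ℝ) (hζ : ζ ∈ Set.Icc (0 : ℝ) 1) :
    C / (2 * π) ≤
      (1 + C / d - ζ) / Real.sqrt (ζ ^ 2 - 2 * ζ * Real.cos (2 * π / d) + 1) := by
  obtain ⟨h0, h1⟩ := hζ
  have hd' : (2 : ℝ) ≤ d := by exact_mod_cast hd
  have hθ : 0 < 2 * π / d := by positivity
  have hθπ : 2 * π / d ≤ π := by
    rw [div_le_iff₀ (by linarith)]
    nlinarith [pi_pos]
  have hcos : cos (2 * π / d) < 1 := by
    simpa using cos_lt_cos_of_nonneg_of_le_pi le_rfl hθπ hθ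
  rw [le_div_iff₀ (Real.sqrt_pos.mpr (sq_sub_two_mul_cos_add_one_pos h0 hcos))]
  have hk : C / (2 * π) ≤ 1 := div_le_one_of_le₀ hC (by positivity)
  calc C / (2 * π) * √(ζ ^ 2 - 2 * ζ * cos (2 * π / d) + 1)
      ≤ C / (2 * π) * (1 - ζ + 2 * π / d) := by
        gcongr
        exact sqrt_sq_sub_two_mul_cos_add_one_le h0 h1 hθ.le
    _ = C / (2 * π) * (1 - ζ) + C / d := by field_simp
    _ ≤ 1 + C / d - ζ := by nlinarith [mul_le_mul_of_nonneg_right hk (sub_nonneg.mpr h1)]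
end

section
/- The function θ ↦ log((4 + tan θ)/(sec θ − 1)) is integrable on the open interval (0, π/2), and 2·∫₀^{π/2} log((4 + tan θ)/(sec θ − 1)) dθ < 9.3. -/
open Real MeasureTheory

/-- The phase of `4 cos θ + sin θ`. -/
theorem sqrt_mul_cos_sub_arctan (θ : ℝ) :
    √17 * cos (θ - arctan (1 / 4)) = 4 * cos θ + sin θ := by
  have h : √(1 + (1 / 4 : ℝ) ^ 2) = √17 / 4 := by
    rw [show (1 + (1 / 4 : ℝ) ^ 2) = 17 / 4 ^ 2 by norm_num, sqrt_div (by norm_num),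
      sqrt_sq (by norm_num)]
  have h17 : √17 ≠ 0 := by positivity
  rw [cos_sub, cos_arctan, sin_arctan, h]
  field_simp

theorem arctan_quarter_bounds : 0.2449 < arctan (1 / 4) ∧ arctan (1 / 4) < 0.245 := by
  have hpi := pi_gt_three
  constructor
  · rw [← arctan_tan (x := 0.2449) (by linarith) (by linarith), arctan_lt_arctan_iff, tan_eq_sin_div_cos]
    have hs := abs_le.1 (sin_bound (x := 0.2449) (by norm_num [abs_of_pos]))
    have hc := one_sub_sq_div_two_le_cos (x := 0.2449)
    rw [abs_of_pos (by norm_num : (0 : ℝ) < 0.2449)] at hs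
    rw [div_lt_iff₀ (by linarith)]
    linarith [hs.2]
  · rw [← arctan_tan (x := 0.245) (by linarith) (by linarith), arctan_lt_arctan_iff, tan_eq_sin_div_cos]
    have hs := sin_ge_sub_cube (x := 0.245) (by norm_num)
    have hc := abs_le.1 (cos_bound (x := 0.245) (by norm_num [abs_of_pos]))
    have hc' := one_sub_sq_div_two_le_cos (x := 0.245)
    rw [abs_of_pos (by norm_num : (0 : ℝ) < 0.245)] at hc
    rw [lt_div_iff₀ (by linarith)]
    linarith [hc.2]

theorem log_integrand_eq {θ : ℝ} (hθ : θ ∈ Set.Ioo 0 (π / 2)) :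
    log ((4 + tan θ) / (1 / cos θ - 1)) =
      log 17 / 2 - log 2 + log (cos (θ - arctan (1 / 4))) - 2 * log (sin (θ / 2)) := by
  obtain ⟨h0, h1⟩ := hθ
  have hc : 0 < cos θ := cos_pos_of_mem_Ioo ⟨by linarith, h1⟩
  have hs : 0 < sin θ := sin_pos_of_pos_of_lt_pi h0 (by linarith)
  have hs2 : 0 < sin (θ / 2) := sin_pos_of_pos_of_lt_pi (by linarith) (by linarith)
  have hcos : 1 - cos θ = 2 * sin (θ / 2) ^ 2 := by
    rw [sin_sq_eq_half_sub, mul_div_cancel₀ θ two_ne_zero]; ring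
  have hph := sqrt_mul_cos_sub_arctan θ
  have hpos : 0 < cos (θ - arctan (1 / 4)) := by
    have : 0 < √17 * cos (θ - arctan (1 / 4)) := by rw [hph]; positivity
    exact pos_of_mul_pos_right this (sqrt_nonneg _)
  have hfrac : (4 + tan θ) / (1 / cos θ - 1) =
      √17 * cos (θ - arctan (1 / 4)) / (2 * sin (θ / 2) ^ 2) := by
    rw [hph, ← hcos, tan_eq_sin_div_cos]
    have : 1 - cos θ ≠ 0 := by rw [hcos]; positivity
    have : 1 / cos θ - 1 ≠ 0 := by
      rw [div_sub_one hc.ne']; exact div_ne_zero this hc.ne'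
    field_simp
  rw [hfrac, log_div (by positivity) (by positivity), log_mul (by positivity) hpos.ne',
    log_mul two_ne_zero (by positivity), log_pow, log_sqrt (by norm_num)]
  push_cast
  ring

theorem neg_log_sin_le {x : ℝ} (h0 : 0 < x) (h1 : x ≤ π / 4) :
    -log (sin x) ≤ -log x + x ^ 2 / 6 + 0.0155 * x ^ 4 := by
  have hx : x ≤ 0.7854 := by linarith [pi_lt_d6]
  set u := x ^ 2 / 6 with hu
  have hu0 : 0 < u := by positivity
  have hu1 : u ≤ 0.103 := by rw [hu]; nlinarith
  have hsin : x * (1 - u) ≤ sin x := by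
    have := sin_ge_sub_cube h0.le
    rw [hu]; linarith
  have hlog : log x + log (1 - u) ≤ log (sin x) := by
    rw [← log_mul h0.ne' (by linarith)]
    exact log_le_log (mul_pos h0 (by linarith)) hsin
  have hb := (abs_le.1 (abs_log_sub_add_sum_range_le (x := u) (by rw [abs_of_pos hu0]; linarith) 3)).1
  rw [abs_of_pos hu0] at hb
  norm_num [Finset.sum_range_succ] at hb
  have hq : u ^ 4 / (1 - u) ≤ 0.012 * u ^ 2 := by
    rw [div_le_iff₀ (by linarith)]
    have h2 : u ^ 2 ≤ 0.012 * (1 - u) := by nlinarith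
    calc u ^ 4 = u ^ 2 * u ^ 2 := by ring
      _ ≤ u ^ 2 * (0.012 * (1 - u)) := by gcongr
      _ = 0.012 * u ^ 2 * (1 - u) := by ring
  have hc : u ^ 3 ≤ 0.103 * u ^ 2 := by nlinarith [sq_nonneg u]
  have hx4 : x ^ 4 = 36 * u ^ 2 := by rw [hu]; ring
  rw [hx4]
  nlinarith [sq_nonneg u]

theorem neg_integral_log_sin_le {a : ℝ} (h0 : 0 < a) (h1 : a ≤ π / 4) :
    -∫ x in 0..a, log (sin x) ≤ a - a * log a + a ^ 3 / 18 + 0.0031 * a ^ 5 := by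
  have hint : IntervalIntegrable (fun x => -log x) volume 0 a :=
    intervalIntegral.intervalIntegrable_log'.neg
  have hpoly : IntervalIntegrable (fun x : ℝ => x ^ 2 / 6 + 0.0155 * x ^ 4) volume 0 a :=
    Continuous.intervalIntegrable (by fun_prop) _ _
  rw [← intervalIntegral.integral_neg]
  calc ∫ x in 0..a, -log (sin x)
      ≤ ∫ x in 0..a, (-log x + (x ^ 2 / 6 + 0.0155 * x ^ 4)) := by
        apply intervalIntegral.integral_mono_on_of_le_Ioo h0.le
          intervalIntegrable_log_sin.neg (hint.add hpoly)
        intro x hx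
        change -log (sin x) ≤ _
        linarith [neg_log_sin_le hx.1 (hx.2.le.trans h1)]
    _ = a - a * log a + a ^ 3 / 18 + 0.0031 * a ^ 5 := by
        rw [intervalIntegral.integral_add hint hpoly, intervalIntegral.integral_neg, integral_log_from_zero,
          intervalIntegral.integral_add (Continuous.intervalIntegrable (by fun_prop) _ _)
            (Continuous.intervalIntegrable (by fun_prop) _ _),
          intervalIntegral.integral_div, intervalIntegral.integral_const_mul, integral_pow, integral_pow]
        norm_num
        ring

theorem integral_log_cos_le {a : ℝ} (h0 : 0 < a) (h1 : a ≤ 1) :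
    ∫ x in 0..a, log (cos x) ≤ -a ^ 3 / 6 + a ^ 5 / 96 := by
  calc ∫ x in 0..a, log (cos x)
      ≤ ∫ x in 0..a, (-(1 / 2) * x ^ 2 + 5 / 96 * x ^ 4) := by
        apply intervalIntegral.integral_mono_on_of_le_Ioo h0.le
          intervalIntegrable_log_cos (Continuous.intervalIntegrable (by fun_prop) _ _)
        intro x hx
        have hb := (abs_le.1 (cos_bound (x := x)
          (by rw [abs_of_pos hx.1]; exact hx.2.le.trans h1))).2
        rw [abs_of_pos hx.1] at hb
        have := log_le_sub_one_of_pos (cos_pos_of_le_one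
          (by rw [abs_of_pos hx.1]; exact hx.2.le.trans h1))
        change log (cos x) ≤ _
        linarith
    _ = -a ^ 3 / 6 + a ^ 5 / 96 := by
        rw [intervalIntegral.integral_add (Continuous.intervalIntegrable (by fun_prop) _ _)
            (Continuous.intervalIntegrable (by fun_prop) _ _),
          intervalIntegral.integral_const_mul, intervalIntegral.integral_const_mul, integral_pow, integral_pow]
        norm_num
        ring

theorem integral_log_cos_sub (a : ℝ) :
    ∫ θ in 0..(π / 2), log (cos (θ - a)) =
      (∫ x in 0..a, log (cos x)) - log 2 * π / 2 - ∫ x in 0..a, log (sin x) := by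
  have hI : ∀ b c : ℝ, IntervalIntegrable (fun x => log (cos x)) volume b c :=
    fun _ _ => intervalIntegrable_log_cos
  have hreflect : ∀ b c : ℝ, ∫ x in b..c, log (cos x) = ∫ x in (π / 2 - c)..(π / 2 - b), log (sin x) := by
    intro b c
    rw [← intervalIntegral.integral_comp_sub_left (fun x => log (sin x))]
    simp only [sin_pi_div_two_sub]
  have hneg : ∫ x in (-a)..0, log (cos x) = ∫ x in 0..a, log (cos x) := by
    have := intervalIntegral.integral_comp_neg (fun x => log (cos x)) (a := 0) (b := a)
    simpa using this.symm
  have hhalf := hreflect 0 (π / 2)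
  have htail := hreflect (π / 2 - a) (π / 2)
  simp only [sub_self, sub_zero, sub_sub_cancel, integral_log_sin_zero_pi_div_two] at hhalf htail
  rw [intervalIntegral.integral_comp_sub_right (fun x => log (cos x)), zero_sub]
  have h1 := intervalIntegral.integral_add_adjacent_intervals (hI (-a) 0) (hI 0 (π / 2 - a))
  have h2 := intervalIntegral.integral_add_adjacent_intervals (hI 0 (π / 2 - a)) (hI (π / 2 - a) (π / 2))
  linarith

theorem log_combination_le : log 17 + 4 * log 2 - 4 * log π ≤ 1.0295 := by
  have hpow : (97.2 : ℝ) ≤ π ^ 4 := by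
    calc (97.2 : ℝ) ≤ 3.1415 ^ 4 := by norm_num
      _ ≤ π ^ 4 := by gcongr; exact pi_gt_d4.le
  have h1 : 2 * (log 17 + 4 * log 2 - 4 * log π) = 3 * log 2 + log (17 ^ 2 * 2 ^ 5 / (π ^ 4) ^ 2) := by
    rw [log_div (by positivity) (by positivity), log_mul (by positivity) (by positivity)]
    simp only [log_pow]
    push_cast
    ring
  have h2 := log_le_sub_one_of_pos (show 0 < 17 ^ 2 * 2 ^ 5 / (π ^ 4) ^ 2 by positivity)
  have h3 : 17 ^ 2 * 2 ^ 5 / (π ^ 4) ^ 2 ≤ 0.979 := by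
    rw [div_le_iff₀ (by positivity)]
    nlinarith
  linarith [log_two_lt_d9]

theorem one_sub_log_arctan_quarter_le : 1 - log (arctan (1 / 4)) ≤ 2.4075 := by
  have h := log_le_log (by norm_num) arctan_quarter_bounds.1.le
  have h1 : log (0.2449 : ℝ) = -log (1 / 0.9796) - 2 * log 2 := by
    rw [show (0.2449 : ℝ) = 0.9796 / 2 ^ 2 by norm_num, log_div (by norm_num) (by norm_num),
      log_pow, one_div, log_inv]
    push_cast
    ring
  have h2 := log_le_sub_one_of_pos (show (0 : ℝ) < 1 / 0.9796 by norm_num)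
  norm_num at h h1 h2 ⊢
  linarith [log_two_lt_d9]

theorem stmt_12 :
    IntegrableOn (fun θ : ℝ => Real.log ((4 + Real.tan θ) / (1 / Real.cos θ - 1)))
        (Set.Ioo 0 (π / 2)) volume ∧
    2 * ∫ θ in Set.Ioo 0 (π / 2),
        Real.log ((4 + Real.tan θ) / (1 / Real.cos θ - 1)) < 9.3 := by
  have hle : 0 ≤ π / 2 := by positivity
  have hcos : IntervalIntegrable (fun θ => log (cos (θ - arctan (1 / 4)))) volume 0 (π / 2) := by
    simpa using (intervalIntegrable_log_cos (a := -arctan (1 / 4))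
      (b := π / 2 - arctan (1 / 4))).comp_sub_right (arctan (1 / 4))
  have hsin : IntervalIntegrable (fun θ => log (sin (θ / 2))) volume 0 (π / 2) := by
    have h := (intervalIntegrable_log_sin (a := 0) (b := π / 4)).comp_mul_right (c := 1 / 2)
    rw [zero_div, show π / 4 / (1 / 2) = π / 2 by ring] at h
    simpa only [Function.comp_def, mul_one_div] using h
  have hconst : IntervalIntegrable (fun _ => log 17 / 2 - log 2) volume 0 (π / 2) :=
    intervalIntegrable_const
  have hall := (hconst.add hcos).sub (hsin.const_mul 2)
  refine ⟨((intervalIntegrable_iff_integrableOn_Ioo_of_le hle).1 hall).congr_fun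
    (fun θ hθ => (log_integrand_eq hθ).symm) measurableSet_Ioo, ?_⟩
  rw [setIntegral_congr_fun measurableSet_Ioo (fun θ hθ => log_integrand_eq hθ),
    ← integral_Ioc_eq_integral_Ioo, ← intervalIntegral.integral_of_le hle,
    intervalIntegral.integral_sub (hconst.add hcos) (hsin.const_mul 2),
    intervalIntegral.integral_add hconst hcos, intervalIntegral.integral_const,
    intervalIntegral.integral_const_mul, integral_log_cos_sub,
    intervalIntegral.integral_comp_div (fun x => log (sin x)) two_ne_zero,
    show π / 2 / 2 = π / 4 by ring, zero_div]
  obtain ⟨hφ0, hφ1⟩ := arctan_quarter_bounds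
  have hlogφ := one_sub_log_arctan_quarter_le
  set φ := arctan (1 / 4)
  have hφ : 0 < φ := by linarith
  have hpi := pi_gt_three
  have hA := neg_integral_log_sin_le hφ (by linarith)
  have hB := neg_integral_log_sin_le (a := π / 4) (by positivity) le_rfl
  have hC := integral_log_cos_le hφ (by linarith)
  have hD : φ * (1 - log φ) ≤ 0.245 * 2.4075 := by
    calc φ * (1 - log φ) ≤ φ * 2.4075 := by gcongr
      _ ≤ 0.245 * 2.4075 := by gcongr
  have hlogπ : log (π / 4) = log π - 2 * log 2 := by
    rw [log_div (by positivity) (by norm_num), show (4 : ℝ) = 2 ^ 2 by norm_num, log_pow]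
    push_cast
    ring
  have hE : π / 4 * (log 17 + 4 * log 2 - 4 * log π) ≤ π / 4 * 1.0295 := by
    gcongr
    exact log_combination_le
  have hπ := pi_lt_d6
  have h3 : φ ^ 3 ≤ 0.245 ^ 3 := by gcongr
  have h3' : 0.2449 ^ 3 ≤ φ ^ 3 := by gcongr
  have h5 : φ ^ 5 ≤ 0.245 ^ 5 := by gcongr
  have hπ3 : (π / 4) ^ 3 ≤ (3.141593 / 4) ^ 3 := by gcongr
  have hπ5 : (π / 4) ^ 5 ≤ (3.141593 / 4) ^ 5 := by gcongr
  rw [hlogπ] at hB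
  simp only [smul_eq_mul, sub_zero]
  linarith
end

section
/- There exists a real number r with 0.1307 < r < 0.13072 such that (2r² − 4r + 1)² = 2r. -/
theorem stmt_13 :
    ∃ r : ℝ, 0.1307 < r ∧ r < 0.13072 ∧ (2 * r ^ 2 - 4 * r + 1) ^ 2 = 2 * r := by
  have hcont : ContinuousOn (fun r : ℝ => (2 * r ^ 2 - 4 * r + 1) ^ 2 - 2 * r)
      (Set.Icc 0.1307 0.13072) := by fun_prop
  obtain ⟨r, ⟨hl, hu⟩, hr⟩ := intermediate_value_Ioo' (by norm_num) hcont
    (show (0 : ℝ) ∈ Set.Ioo _ _ by constructor <;> norm_num)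
  exact ⟨r, hl, hu, sub_eq_zero.mp hr⟩
end
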